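/- There exists an absolute constant c > 0 such that the following holds: for all positive integers d, T and reals R, L > 0 with T ≥ c·d·log(RLT) and RLT ≥ c, there exists a function f: B_2^d(R) × ℝ^d → [0,1] that, for each fixed x ∈ ℝ^d, is L-Lipschitz in w with respect to the ℓ₂ norm on B_2^d(R), such that the class H_f = { f(w,·) : w ∈ B_2^d(R) } with feature space X = ℝ^d satisfies r^a_T(H_f) ≥ d·log(RLT/d) − d·log 64 − d·log log(RLT). -/

import Mathlib

open Set

/-- Logarithmic loss with values in `EReal`. -/
noncomputable def logLoss (p : ℝ) (y : Bool) : EReal :=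
  if y then (if p = 0 then ⊤ else (((-Real.log p : ℝ)) : EReal))
  else (if p = 1 then ⊤ else (((-Real.log (1 - p) : ℝ)) : EReal))

noncomputable def lossSum (ps : List ℝ) (ys : List Bool) : EReal :=
  (List.zipWith logLoss ps ys).sum

noncomputable def expertLoss {X : Type*} (h : X → ℝ) (xs : List X) (ys : List Bool) : EReal :=
  (List.zipWith (fun x y => logLoss (h x) y) xs ys).sum

noncomputable def pointwiseRegret {X : Type*} (H : Set (X → ℝ))
    (xs : List X) (ps : List ℝ) (ys : List Bool) : EReal :=
  lossSum ps ys - ⨅ h ∈ H, expertLoss h xs ys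

noncomputable def seqRegretAux {X : Type*} (H : Set (X → ℝ)) :
    ℕ → List X → List ℝ → List Bool → EReal
  | 0, xs, ps, ys => pointwiseRegret H xs ps ys
  | n+1, xs, ps, ys =>
      ⨆ x : X, ⨅ p : Set.Icc (0:ℝ) 1, ⨆ y : Bool,
        seqRegretAux H n (xs ++ [x]) (ps ++ [(p : ℝ)]) (ys ++ [y])

/-- Sequential (agnostic) minimax regret `r^a_T(H)`. -/
noncomputable def seqRegret {X : Type*} (H : Set (X → ℝ)) (T : ℕ) : EReal :=
  seqRegretAux H T [] [] []

/-- The probability that a Bernoulli variable of parameter `p` takes the value `y`. -/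
noncomputable def bern (p : ℝ) (y : Bool) : ℝ := if y then p else 1 - p

/-- The likelihood that the expert `h` gives to the labels `ys` on the features `xs`. -/
noncomputable def likelihood {X : Type*} (h : X → ℝ) (xs : List X) (ys : List Bool) : ℝ :=
  (List.zipWith (fun x y => bern (h x) y) xs ys).prod

/-- A lower bound for the largest weight after `n` more rounds, when each round multiplies the
mean pairwise Hellinger affinity by `r`. -/
noncomputable def potential {ι : Type*} [Fintype ι] [DecidableEq ι] (r : ℝ) (n : ℕ)
    (v : ι → ℝ) : ℝ :=
  ∑ i, v i - r ^ n * ∑ p ∈ (Finset.univ : Finset ι).offDiag, √(v p.1) * √(v p.2)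

lemma bern_nonneg {p : ℝ} (hp : p ∈ Icc (0 : ℝ) 1) (y : Bool) : 0 ≤ bern p y := by
  cases y <;> simp [bern, hp.1, hp.2]

lemma logLoss_eq_neg_log_bern {p : ℝ} {y : Bool} (h : bern p y ≠ 0) :
    logLoss p y = ((-Real.log (bern p y) : ℝ) : EReal) := by
  cases y
  · have : p ≠ 1 := fun hp => h (by simp [bern, hp])
    simp [logLoss, bern, this]
  · have : p ≠ 0 := fun hp => h (by simp [bern, hp])
    simp [logLoss, bern, this]

lemma logLoss_eq_top {p : ℝ} {y : Bool} (h : bern p y = 0) : logLoss p y = ⊤ := by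
  cases y
  · have : p = 1 := by simp [bern] at h; linarith
    simp [logLoss, this]
  · have : p = 0 := by simpa [bern] using h
    simp [logLoss, this]

lemma likelihood_append {X : Type*} (h : X → ℝ) {xs : List X} {ys : List Bool}
    (hl : xs.length = ys.length) (x : X) (y : Bool) :
    likelihood h (xs ++ [x]) (ys ++ [y]) = likelihood h xs ys * bern (h x) y := by
  simp [likelihood, List.zipWith_append hl]

lemma lossSum_append {ps : List ℝ} {ys : List Bool} (hl : ps.length = ys.length)
    (p : ℝ) (y : Bool) : lossSum (ps ++ [p]) (ys ++ [y]) = lossSum ps ys + logLoss p y := by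
  simp [lossSum, List.zipWith_append hl]

lemma likelihood_nonneg {X : Type*} {h : X → ℝ} (hh : ∀ x, h x ∈ Icc (0 : ℝ) 1)
    (xs : List X) (ys : List Bool) : 0 ≤ likelihood h xs ys := by
  apply List.prod_nonneg
  intro a ha
  rw [← List.map_uncurry_zip_eq_zipWith, List.mem_map] at ha
  obtain ⟨q, -, rfl⟩ := ha
  exact bern_nonneg (hh _) _

lemma expertLoss_eq_neg_log_likelihood {X : Type*} (h : X → ℝ) (xs : List X) (ys : List Bool)
    (hv : likelihood h xs ys ≠ 0) :
    expertLoss h xs ys = ((-Real.log (likelihood h xs ys) : ℝ) : EReal) := by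
  induction xs generalizing ys with
  | nil => simp [expertLoss, likelihood]
  | cons x xs ih =>
    cases ys with
    | nil => simp [expertLoss, likelihood]
    | cons y ys =>
      have hc : likelihood h (x :: xs) (y :: ys) = bern (h x) y * likelihood h xs ys := by
        simp [likelihood]
      have hc' : expertLoss h (x :: xs) (y :: ys) = logLoss (h x) y + expertLoss h xs ys := by
        simp [expertLoss]
      rw [hc] at hv ⊢
      rw [hc', ih ys (right_ne_zero_of_mul hv), logLoss_eq_neg_log_bern (left_ne_zero_of_mul hv),
        Real.log_mul (left_ne_zero_of_mul hv) (right_ne_zero_of_mul hv), ← EReal.coe_add]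
      congr 1
      ring

lemma exists_potential_zero_le {ι : Type*} [Fintype ι] [DecidableEq ι] [Nonempty ι] (r : ℝ)
    {v : ι → ℝ} (hv : ∀ i, 0 ≤ v i) : ∃ i, potential r 0 v ≤ v i := by
  obtain ⟨i, hi⟩ := Finite.exists_max v
  refine ⟨i, ?_⟩
  have hsum : ∑ j ∈ Finset.univ.erase i, v j
      ≤ ∑ p ∈ (Finset.univ : Finset ι).offDiag, √(v p.1) * √(v p.2) := by
    calc ∑ j ∈ Finset.univ.erase i, v j
        ≤ ∑ j ∈ Finset.univ.erase i, √(v i) * √(v j) := by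
          refine Finset.sum_le_sum fun j _ => ?_
          calc v j = √(v j) * √(v j) := (Real.mul_self_sqrt (hv j)).symm
            _ ≤ √(v i) * √(v j) := by gcongr; exact hi j
      _ = ∑ p ∈ (Finset.univ.erase i).image (fun j => (i, j)), √(v p.1) * √(v p.2) := by
          rw [Finset.sum_image (by intro a _ b _ h; simpa using h)]
      _ ≤ _ := by
          refine Finset.sum_le_sum_of_subset_of_nonneg ?_ fun _ _ _ => by positivity
          intro p hp
          simp only [Finset.mem_image, Finset.mem_erase] at hp
          obtain ⟨j, hj, rfl⟩ := hp
          simpa using hj.1.symm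
  have := Finset.add_sum_erase Finset.univ v (Finset.mem_univ i)
  simp only [potential, pow_zero, one_mul]
  linarith

lemma sum_affinity {ι : Type*} [Fintype ι] [DecidableEq ι] {ε : ℝ} (hε : ε ∈ Icc (0 : ℝ) 1)
    {i j : ι} (hij : i ≠ j) :
    ∑ s : ι → Bool, ∑ y, √(bern (if s i then ε else 0) y) * √(bern (if s j then ε else 0) y)
      = ∑ _s : ι → Bool, (1 + √(1 - ε)) / 2 := by
  set B : (ι → Bool) → ℝ :=
    fun s => ∑ y, √(bern (if s i then ε else 0) y) * √(bern (if s j then ε else 0) y)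
  have hflip : Function.Involutive fun s : ι → Bool => Function.update s i (!s i) := by
    intro s
    simp
  have h1 : ∑ s, B s = ∑ s, B (Function.update s i (!s i)) :=
    (Equiv.sum_comp hflip.toPerm B).symm
  have h2 : ∀ s, B s + B (Function.update s i (!s i)) = 1 + √(1 - ε) := by
    intro s
    have e1 : √ε * √ε = ε := Real.mul_self_sqrt hε.1
    have e2 : √(1 - ε) * √(1 - ε) = 1 - ε := Real.mul_self_sqrt (by linarith [hε.2])
    simp only [B, Fintype.sum_bool, bern, Function.update_self, Function.update_of_ne hij.symm]
    cases s i <;> cases s j <;> simp [e1, e2] <;> ring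
  have h3 : ∑ s, B s + ∑ s, B s = ∑ _s : ι → Bool, (1 + √(1 - ε)) := by
    nth_rewrite 2 [h1]
    rw [← Finset.sum_add_distrib]
    exact Finset.sum_congr rfl fun s _ => h2 s
  change ∑ s, B s = _
  rw [← Finset.sum_div]
  linarith

/-- Some query of the code does not decrease the total potential. -/
lemma exists_potential_succ_le {ι : Type*} [Fintype ι] [DecidableEq ι] {ε : ℝ}
    (hε : ε ∈ Icc (0 : ℝ) 1) (n : ℕ) {v : ι → ℝ} (hv : ∀ i, 0 ≤ v i) :
    ∃ s : ι → Bool, potential ((1 + √(1 - ε)) / 2) (n + 1) v ≤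
      ∑ y, potential ((1 + √(1 - ε)) / 2) n
        (fun i => v i * bern (if s i then ε else 0) y) := by
  set r := (1 + √(1 - ε)) / 2
  set B : (ι → Bool) → ι × ι → ℝ := fun s p =>
    ∑ y, √(bern (if s p.1 then ε else 0) y) * √(bern (if s p.2 then ε else 0) y)
  have key : ∀ s : ι → Bool,
      ∑ y, potential r n (fun i => v i * bern (if s i then ε else 0) y)
        = ∑ i, v i - r ^ n * ∑ p ∈ (Finset.univ : Finset ι).offDiag,
            √(v p.1) * √(v p.2) * B s p := by
    intro s
    simp only [potential]
    rw [Finset.sum_sub_distrib, ← Finset.mul_sum, Finset.sum_comm]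
    congr 1
    · refine Finset.sum_congr rfl fun i _ => ?_
      rw [Fintype.sum_bool, ← mul_add]
      simp [bern]
    · congr 1
      rw [Finset.sum_comm]
      refine Finset.sum_congr rfl fun p _ => ?_
      rw [Finset.mul_sum]
      refine Finset.sum_congr rfl fun y _ => ?_
      rw [Real.sqrt_mul (hv _), Real.sqrt_mul (hv _)]
      ring
  have hsum : ∑ _s : ι → Bool, potential r (n + 1) v ≤
      ∑ s : ι → Bool, ∑ y, potential r n (fun i => v i * bern (if s i then ε else 0) y) := by
    apply le_of_eq
    simp only [key]
    simp only [potential]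
    rw [Finset.sum_sub_distrib, Finset.sum_sub_distrib]
    congr 1
    simp only [Finset.mul_sum]
    rw [Finset.sum_comm]
    conv_rhs => rw [Finset.sum_comm]
    refine Finset.sum_congr rfl fun p hp => ?_
    have hp' : p.1 ≠ p.2 := by simpa using hp
    have haff : ∑ s, B s p = ∑ _s : ι → Bool, r := sum_affinity hε hp'
    calc ∑ _s : ι → Bool, r ^ (n + 1) * (√(v p.1) * √(v p.2))
        = r ^ n * (√(v p.1) * √(v p.2)) * ∑ _s : ι → Bool, r := by
          rw [Finset.mul_sum]
          exact Finset.sum_congr rfl fun s _ => by ring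
      _ = ∑ s, r ^ n * (√(v p.1) * √(v p.2) * B s p) := by
          rw [← haff, Finset.mul_sum]
          exact Finset.sum_congr rfl fun s _ => by ring
  obtain ⟨s, -, hs⟩ := Finset.exists_le_of_sum_le Finset.univ_nonempty hsum
  exact ⟨s, hs⟩

/-- Whatever the prediction, some label has a large potential relative to its probability. -/
lemma exists_label {A : Bool → ℝ} {Φ : ℝ} (hΦ : 0 < Φ) (hA : Φ ≤ ∑ y, A y) {p : ℝ}
    (hp : p ∈ Icc (0 : ℝ) 1) : ∃ y, 0 < A y ∧ bern p y * Φ ≤ A y := by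
  obtain ⟨h0, h1⟩ := hp
  rw [Fintype.sum_bool] at hA
  by_contra! hcon
  have ht := hcon true
  have hf := hcon false
  simp only [bern] at ht hf
  norm_num at ht hf
  by_cases hAt : 0 < A true
  · have := ht hAt
    by_cases hAf : 0 < A false
    · have := hf hAf
      nlinarith
    · nlinarith
  · have := hf (by linarith)
    nlinarith

theorem lossSum_add_log_potential_le {X ι : Type*} [Fintype ι] [DecidableEq ι] [Nonempty ι]
    (H : Set (X → ℝ)) {ε : ℝ} (hε : ε ∈ Icc (0 : ℝ) 1) (h : ι → X → ℝ) (hH : ∀ i, h i ∈ H)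
    (h01 : ∀ i x, h i x ∈ Icc (0 : ℝ) 1) (e : (ι → Bool) → X)
    (he : ∀ s i, h i (e s) = if s i then ε else 0) (n : ℕ) (xs : List X) (ps : List ℝ)
    (ys : List Bool) (hx : xs.length = ys.length) (hp : ps.length = ys.length)
    (hpos : 0 < potential ((1 + √(1 - ε)) / 2) n (fun i => likelihood (h i) xs ys)) :
    lossSum ps ys +
        (Real.log (potential ((1 + √(1 - ε)) / 2) n (fun i => likelihood (h i) xs ys)) : EReal)
      ≤ seqRegretAux H n xs ps ys := by
  induction n generalizing xs ps ys with
  | zero =>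
    obtain ⟨i, hi⟩ := exists_potential_zero_le ((1 + √(1 - ε)) / 2)
      (v := fun i => likelihood (h i) xs ys) fun i => likelihood_nonneg (h01 i) xs ys
    have hinf : ⨅ g ∈ H, expertLoss g xs ys
        ≤ ((-Real.log (likelihood (h i) xs ys) : ℝ) : EReal) := by
      rw [← expertLoss_eq_neg_log_likelihood _ _ _ (hpos.trans_le hi).ne']
      exact iInf₂_le _ (hH i)
    rw [seqRegretAux, pointwiseRegret, sub_eq_add_neg]
    refine add_le_add le_rfl ?_
    rw [EReal.le_neg]
    refine hinf.trans ?_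
    rw [← EReal.coe_neg, EReal.coe_le_coe_iff]
    exact neg_le_neg (Real.log_le_log hpos hi)
  | succ n ih =>
    obtain ⟨s, hs⟩ := exists_potential_succ_le hε n
      (v := fun i => likelihood (h i) xs ys) fun i => likelihood_nonneg (h01 i) xs ys
    rw [seqRegretAux]
    refine le_iSup_of_le (e s) (le_iInf fun p => ?_)
    obtain ⟨y, hy, hpy⟩ := exists_label hpos hs p.2
    refine le_iSup_of_le y ?_
    have hpot : potential ((1 + √(1 - ε)) / 2) n
        (fun i => likelihood (h i) (xs ++ [e s]) (ys ++ [y])) =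
        potential ((1 + √(1 - ε)) / 2) n
          (fun i => likelihood (h i) xs ys * bern (if s i then ε else 0) y) := by
      simp only [likelihood_append _ hx, he]
    refine le_trans ?_ (ih (xs ++ [e s]) (ps ++ [(p : ℝ)]) (ys ++ [y]) (by simp [hx])
      (by simp [hp]) (hpot ▸ hy))
    rw [hpot, lossSum_append hp, add_assoc]
    refine add_le_add le_rfl ?_
    by_cases hb : bern p y = 0
    · rw [logLoss_eq_top hb, EReal.top_add_coe]
      exact le_top
    · have hb' : 0 < bern p y := lt_of_le_of_ne (bern_nonneg p.2 y) (Ne.symm hb)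
      rw [logLoss_eq_neg_log_bern hb, ← EReal.coe_add, EReal.coe_le_coe_iff]
      have := Real.log_le_log (mul_pos hb' hpos) hpy
      rw [Real.log_mul hb hpos.ne'] at this
      linarith

theorem log_card_div_two_le_seqRegret {X ι : Type*} [Fintype ι] [DecidableEq ι] [Nonempty ι]
    (H : Set (X → ℝ)) {ε : ℝ} (hε : ε ∈ Icc (0 : ℝ) 1) (h : ι → X → ℝ) (hH : ∀ i, h i ∈ H)
    (h01 : ∀ i x, h i x ∈ Icc (0 : ℝ) 1) (e : (ι → Bool) → X)
    (he : ∀ s i, h i (e s) = if s i then ε else 0) (T : ℕ)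
    (hT : Fintype.card ι * Real.exp (-(ε * T / 4)) ≤ 1 / 2) :
    (Real.log (Fintype.card ι / 2) : EReal) ≤ seqRegret H T := by
  set r := (1 + √(1 - ε)) / 2 with hr
  have hN : (0 : ℝ) < Fintype.card ι := by exact_mod_cast Fintype.card_pos
  have hr0 : 0 ≤ r := by positivity
  have hr1 : r ≤ Real.exp (-(ε / 4)) := by
    have h1 : √(1 - ε) ≤ 1 - ε / 2 := by
      rw [Real.sqrt_le_left (by linarith [hε.2])]
      nlinarith [sq_nonneg ε]
    have h2 := Real.add_one_le_exp (-(ε / 4))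
    rw [hr]
    linarith
  have hrT : r ^ T ≤ Real.exp (-(ε * T / 4)) := by
    calc r ^ T ≤ Real.exp (-(ε / 4)) ^ T := by gcongr
      _ = Real.exp (-(ε * T / 4)) := by rw [← Real.exp_nat_mul]; congr 1; ring
  have hpot : potential r T (fun i => likelihood (h i) [] []) =
      Fintype.card ι - r ^ T * ((Finset.univ : Finset ι).offDiag.card : ℝ) := by
    simp [potential, likelihood]
  have hcard : ((Finset.univ : Finset ι).offDiag.card : ℝ)
      ≤ Fintype.card ι * Fintype.card ι := by
    rw [Finset.offDiag_card]
    exact_mod_cast Nat.sub_le _ _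
  have hge : (Fintype.card ι : ℝ) / 2 ≤ potential r T (fun i => likelihood (h i) [] []) := by
    rw [hpot]
    have h1 : r ^ T * ((Finset.univ : Finset ι).offDiag.card : ℝ)
        ≤ Real.exp (-(ε * T / 4)) * (Fintype.card ι * Fintype.card ι) := by gcongr
    nlinarith
  have hmain := lossSum_add_log_potential_le H hε h hH h01 e he T [] [] [] rfl rfl
    (lt_of_lt_of_le (by positivity) hge)
  refine le_trans ?_ hmain
  rw [lossSum, List.zipWith_nil_left, List.sum_nil, zero_add, EReal.coe_le_coe_iff]
  exact Real.log_le_log (by positivity) hge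

/-- Greedy packing of the Euclidean ball. -/
lemma exists_separated_finset {d : ℕ} {R δ : ℝ} (hR : 0 < R) (hδ : 0 < δ) (N : ℕ)
    (hN : (N : ℝ) < (R / δ) ^ d + 1) :
    ∃ A : Finset (EuclideanSpace ℝ (Fin d)), A.card = N ∧
      (∀ a ∈ A, a ∈ Metric.closedBall (0 : EuclideanSpace ℝ (Fin d)) R) ∧
      ∀ a ∈ A, ∀ b ∈ A, a ≠ b → δ ≤ dist a b := by
  classical
  induction N with
  | zero => exact ⟨∅, by simp⟩
  | succ k ih =>
    push_cast at hN
    obtain ⟨A, hcard, hball, hsep⟩ := ih (by linarith)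
    have hex : ∃ x ∈ Metric.closedBall (0 : EuclideanSpace ℝ (Fin d)) R,
        ∀ a ∈ A, δ ≤ dist x a := by
      by_contra! hcon
      have hsub : Metric.closedBall (0 : EuclideanSpace ℝ (Fin d)) R
          ⊆ ⋃ a ∈ A, Metric.ball a δ := by
        intro x hx
        obtain ⟨a, ha, hxa⟩ := hcon x hx
        exact mem_iUnion₂.mpr ⟨a, ha, hxa⟩
      have hvol := (MeasureTheory.measure_mono (μ := MeasureTheory.volume) hsub).trans
        (MeasureTheory.measure_biUnion_finset_le A _)
      rw [MeasureTheory.Measure.addHaar_closedBall _ _ hR.le,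
        Finset.sum_congr rfl fun a _ => MeasureTheory.Measure.addHaar_ball_of_pos _ a hδ,
        Finset.sum_const, hcard, nsmul_eq_mul, ← mul_assoc,
        ENNReal.mul_le_mul_iff_left (Metric.measure_ball_pos _ _ one_pos).ne'
          MeasureTheory.measure_ball_lt_top.ne, finrank_euclideanSpace_fin,
        ← ENNReal.ofReal_natCast, ← ENNReal.ofReal_mul (by positivity),
        ENNReal.ofReal_le_ofReal_iff (by positivity)] at hvol
      rw [div_pow] at hN
      have : R ^ d / δ ^ d ≤ k := by
        rw [div_le_iff₀ (by positivity)]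
        exact hvol
      linarith
    obtain ⟨x, hx, hxA⟩ := hex
    have hxnot : x ∉ A := fun h => by
      have := hxA x h
      rw [dist_self] at this
      linarith
    refine ⟨insert x A, by rw [Finset.card_insert_of_notMem hxnot, hcard], ?_, ?_⟩
    · intro a ha
      rcases Finset.mem_insert.mp ha with rfl | ha
      · exact hx
      · exact hball a ha
    · intro a ha b hb hab
      rcases Finset.mem_insert.mp ha with rfl | haA <;>
        rcases Finset.mem_insert.mp hb with rfl | hbA
      · exact absurd rfl hab
      · exact hxA b hbA
      · rw [dist_comm]
        exact hxA a haA
      · exact hsep a haA b hbA hab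

/-- Any `{0, ε}`-valued function on a separated set extends to a Lipschitz function
with values in `[0, 1]`. -/
lemma exists_lipschitz_extension {E : Type*} [PseudoMetricSpace E] {L δ ε : ℝ} (hL : 0 < L)
    (hε : ε ∈ Icc (0 : ℝ) 1) (hLδ : ε ≤ L * δ) (A : Finset E)
    (hsep : ∀ a ∈ A, ∀ b ∈ A, a ≠ b → δ ≤ dist a b) (s : A → Bool) :
    ∃ g : E → ℝ, (∀ w, g w ∈ Icc (0 : ℝ) 1) ∧ (∀ w₁ w₂, |g w₁ - g w₂| ≤ L * dist w₁ w₂) ∧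
      ∀ a : A, g a = if s a then ε else 0 := by
  classical
  obtain ⟨h0, h1⟩ := hε
  set u : E → ℝ := fun w => if hw : w ∈ A then (if s ⟨w, hw⟩ then ε else 0) else 0
  have hu01 : ∀ w, 0 ≤ u w ∧ u w ≤ ε := by
    intro w
    simp only [u]
    split_ifs <;> simp [h0]
  have hu : LipschitzOnWith L.toNNReal u A := by
    refine LipschitzOnWith.of_dist_le_mul fun a ha b hb => ?_
    rw [Real.coe_toNNReal _ hL.le]
    by_cases hab : a = b
    · simp [hab]
    · have hδ := mul_le_mul_of_nonneg_left (hsep a ha b hb hab) hL.le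
      have ha' := hu01 a
      have hb' := hu01 b
      rw [Real.dist_eq]
      refine le_trans ?_ (hLδ.trans hδ)
      rw [abs_le]
      constructor <;> linarith
  obtain ⟨g, hg, hgu⟩ := hu.extend_real
  have hlip := (hg.min_const 1).max_const 0
  refine ⟨fun w => max (min (g w) 1) 0, fun w => ⟨le_max_right _ _, ?_⟩, fun w₁ w₂ => ?_,
    fun a => ?_⟩
  · exact max_le (min_le_right _ _) zero_le_one
  · have := hlip.dist_le_mul w₁ w₂
    rwa [Real.coe_toNNReal _ hL.le, Real.dist_eq] at this
  · have ha : g a = if s a then ε else 0 := by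
      rw [← hgu a.2]
      simp [u]
    simp only [ha]
    split_ifs <;> simp [h0, h1]

/-- Theorem 3: there is an absolute constant `c > 0` such that for all `d, T, R, L`
with `T ≥ c d log(RLT)` and `RLT ≥ c`, there exists an `L`-Lipschitz (in the
parameter, w.r.t. the Euclidean norm on the ball of radius `R`) function
`f : B_2^d(R) × ℝ^d → [0,1]` whose induced class satisfies
`r^a_T(H_f) ≥ d log(RLT/d) - d log 64 - d log log (RLT)`. -/
theorem seqRegret_lipschitz_lower :
    ∃ c : ℝ, 0 < c ∧
      ∀ (d T : ℕ) (R L : ℝ), 0 < d → 0 < T → 0 < R → 0 < L →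
        c * (d : ℝ) * Real.log (R * L * (T : ℝ)) ≤ (T : ℝ) →
        c ≤ R * L * (T : ℝ) →
        ∃ f : EuclideanSpace ℝ (Fin d) → (Fin d → ℝ) → ℝ,
          (∀ w ∈ Metric.closedBall (0 : EuclideanSpace ℝ (Fin d)) R,
            ∀ x : Fin d → ℝ, f w x ∈ Set.Icc (0:ℝ) 1) ∧
          (∀ x : Fin d → ℝ, ∀ w₁ ∈ Metric.closedBall (0 : EuclideanSpace ℝ (Fin d)) R,
            ∀ w₂ ∈ Metric.closedBall (0 : EuclideanSpace ℝ (Fin d)) R,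
              |f w₁ x - f w₂ x| ≤ L * ‖w₁ - w₂‖) ∧
          (((d : ℝ) * Real.log (R * L * (T : ℝ) / (d : ℝ)) - (d : ℝ) * Real.log 64 -
              (d : ℝ) * Real.log (Real.log (R * L * (T : ℝ))) : ℝ) : EReal) ≤
            seqRegret {h : (Fin d → ℝ) → ℝ |
              ∃ w ∈ Metric.closedBall (0 : EuclideanSpace ℝ (Fin d)) R, h = f w} T := by
  refine ⟨16, by norm_num, fun d T R L hd hT hR hL hTc hRLT => ?_⟩
  classical
  set Q := R * L * (T : ℝ) with hQ
  have hd1 : (1 : ℝ) ≤ d := by exact_mod_cast hd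
  have hT0 : (0 : ℝ) < T := by exact_mod_cast hT
  have hQ0 : 0 < Q := by linarith
  have hlog : 1 ≤ Real.log Q := by
    rw [Real.le_log_iff_exp_le hQ0]
    linarith [Real.exp_one_lt_d9]
  set M := 16 * (d : ℝ) * Real.log Q with hM
  have hM1 : 1 ≤ M := by nlinarith
  have hM0 : 0 < M := by linarith
  set ε := M / T with hε
  have hε0 : 0 < ε := by positivity
  have hε1 : ε ≤ 1 := by rwa [hε, div_le_one hT0]
  set δ := ε / L with hδ
  have hδ0 : 0 < δ := by positivity
  have hratio : R / δ = Q / M := by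
    rw [hδ, hε, hQ]
    field_simp
  have hbase : 0 < (R / δ) ^ d := by positivity
  obtain ⟨A, hcard, hball, hsep⟩ :=
    exists_separated_finset hR hδ0 ⌈(R / δ) ^ d⌉₊ (Nat.ceil_lt_add_one hbase.le)
  have hAlow : (R / δ) ^ d ≤ A.card := by
    rw [hcard]
    exact Nat.le_ceil _
  have hAup : (A.card : ℝ) ≤ (R / δ) ^ d + 1 := by
    rw [hcard]
    exact (Nat.ceil_lt_add_one hbase.le).le
  have hApos : (0 : ℝ) < A.card := hbase.trans_le hAlow
  have hne : Nonempty A := (Finset.card_pos.mp (by exact_mod_cast hApos)).to_subtype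
  choose g hg01 hglip hgval using fun s : A → Bool =>
    exists_lipschitz_extension hL ⟨hε0.le, hε1⟩ (by rw [hδ]; field_simp; rfl) A hsep s
  set e : (A → Bool) → Fin d → ℝ := fun s _ => (Fintype.equivFin (A → Bool) s : ℕ)
  have he : Function.Injective e := by
    intro s t hst
    have := congrFun hst ⟨0, hd⟩
    simp only [e, Nat.cast_inj] at this
    exact (Fintype.equivFin _).injective (Fin.ext this)
  refine ⟨fun w x => g (Function.invFun e x) w, fun w _ x => hg01 _ w, fun x w₁ _ w₂ _ => ?_, ?_⟩
  · rw [← dist_eq_norm]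
    exact hglip _ w₁ w₂
  refine le_trans ?_ (log_card_div_two_le_seqRegret _ (ε := ε) ⟨hε0.le, hε1⟩
    (fun (a : A) x => g (Function.invFun e x) a) ?_
    (fun a x => hg01 _ _) e (fun s a => ?_) T ?_)
  · rw [EReal.coe_le_coe_iff, Fintype.card_coe]
    have hlhs : (d : ℝ) * Real.log (Q / d) - d * Real.log 64 - d * Real.log (Real.log Q)
        = Real.log ((R / δ / 4) ^ d) := by
      have hl0 : Real.log Q ≠ 0 := by linarith
      have hd0 : (d : ℝ) ≠ 0 := by linarith
      have hrw : R / δ / 4 = Q / d / 64 / Real.log Q := by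
        rw [hratio, hM]
        field_simp
        norm_num
      rw [hrw, Real.log_pow, Real.log_div (x := Q / d / 64) (by positivity) hl0,
        Real.log_div (x := Q / d) (by positivity) (by norm_num)]
      ring
    rw [hlhs]
    refine Real.log_le_log (by positivity) ?_
    have h4 : (4 : ℝ) ≤ 4 ^ d := le_self_pow₀ (by norm_num) hd.ne'
    rw [div_pow]
    calc (R / δ) ^ d / 4 ^ d ≤ A.card / 4 := by gcongr
      _ ≤ A.card / 2 := by linarith
  · exact fun a => ⟨a, hball a a.2, rfl⟩
  · simp only [Function.leftInverse_invFun he s]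
    exact hgval s a
  · rw [Fintype.card_coe]
    have hexp : Real.exp (-(ε * T / 4)) = (Q ^ d)⁻¹ ^ 4 := by
      have : -(ε * T / 4) = -((4 * d : ℕ) * Real.log Q) := by
        rw [hε, hM]
        push_cast
        field_simp
        norm_num
      rw [this, Real.exp_neg, Real.exp_nat_mul, Real.exp_log hQ0, inv_pow, ← pow_mul, mul_comm]
    have hQd : 16 ≤ Q ^ d := hRLT.trans (le_self_pow₀ (by linarith) hd.ne')
    have hup : (A.card : ℝ) ≤ 2 * Q ^ d := by
      have : (R / δ) ^ d ≤ Q ^ d := by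
        rw [hratio]
        gcongr
        exact div_le_self hQ0.le hM1
      linarith
    rw [hexp, inv_pow, ← div_eq_mul_inv, div_le_iff₀ (by positivity)]
    nlinarith [pow_le_pow_left₀ (by norm_num) hQd 3]
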